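/- arXiv:2006.02185 — 2 statements merged into one kernel-verified Lean document; each statement's English description precedes it below -/
import Mathlib

section
/- Let n ≥ 1 and let μ = λ_0 + λ_1·p + ⋯ + λ_{n−1}·p^{n−1} be any integer with digits λ_i ∈ {0, …, p−1}, and let t_{(μ)} := t_{λ_{n−1}} ∘ ⋯ ∘ t_{λ_0} (an n-fold composite, so t_{(μ)}([α : β]) = [α − μβ : p^nβ]). Then t_{(μ)}(ℙ¹(K) ∖ U_0^{(n+1)}) ⊆ U_∞ ∖ U_0^{(1)} and t_{(μ)}(U_∞^{(1)}) ⊆ U_∞^{(n+1)}. -/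
/-! Standard opens of `ℙ¹(K)` for a field `K` with an additive valuation
`v : K → ℤ ∪ {∞}`, and the maps `t_ν([α:β]) = [α − νβ : pβ]`. -/

/-- `[α : β] ∈ U_{0,λ}^{(n)}` iff `v(α − λβ) ≥ n + v(β)`. -/
def U0lam {K : Type*} [Field K] (v : AddValuation K (WithTop ℤ)) (n : ℕ) (lam : ℕ) :
    Set (Projectivization K (K × K)) :=
  {x | ∃ (α β : K) (h : ((α, β) : K × K) ≠ 0),
    x = Projectivization.mk K (α, β) h ∧ (n : WithTop ℤ) + v β ≤ v (α - (lam : K) * β)}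

/-- `U_0^{(n)} = ⋃_{λ=0}^{p^n − 1} U_{0,λ}^{(n)}`. -/
def U0N {K : Type*} [Field K] (p : ℕ) (v : AddValuation K (WithTop ℤ)) (n : ℕ) :
    Set (Projectivization K (K × K)) :=
  {x | ∃ lam < p ^ n, x ∈ U0lam v n lam}

/-- `[α : β] ∈ U_0` iff `v(α − λβ) ≥ v(β)` for some `λ ∈ {0, …, p−1}`. -/
def U0set {K : Type*} [Field K] (p : ℕ) (v : AddValuation K (WithTop ℤ)) :
    Set (Projectivization K (K × K)) :=
  {x | ∃ (α β : K) (h : ((α, β) : K × K) ≠ 0),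
    x = Projectivization.mk K (α, β) h ∧ ∃ lam < p, v β ≤ v (α - (lam : K) * β)}

/-- `[α : β] ∈ U_∞` iff `v(β) ≥ v(α)`. -/
def UinfSet {K : Type*} [Field K] (v : AddValuation K (WithTop ℤ)) :
    Set (Projectivization K (K × K)) :=
  {x | ∃ (α β : K) (h : ((α, β) : K × K) ≠ 0),
    x = Projectivization.mk K (α, β) h ∧ v α ≤ v β}

/-- `[α : β] ∈ U_∞^{(n)}` iff `v(β) ≥ n + v(α)`. -/
def UinfN {K : Type*} [Field K] (v : AddValuation K (WithTop ℤ)) (n : ℕ) :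
    Set (Projectivization K (K × K)) :=
  {x | ∃ (α β : K) (h : ((α, β) : K × K) ≠ 0),
    x = Projectivization.mk K (α, β) h ∧ (n : WithTop ℤ) + v α ≤ v β}

section

variable {K : Type*} [Field K] {v : AddValuation K (WithTop ℤ)}

theorem AddValuation.natCast_nonneg (v : AddValuation K (WithTop ℤ)) (m : ℕ) :
    0 ≤ v (m : K) := by
  induction m with
  | zero => simp
  | succ m ih =>
    rw [Nat.cast_succ]
    exact v.map_le_add ih v.map_one.ge

theorem mk_mem_U0lam {n l : ℕ} {α β : K} (h : ((α, β) : K × K) ≠ 0) :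
    Projectivization.mk K (α, β) h ∈ U0lam v n l ↔
      (n : WithTop ℤ) + v β ≤ v (α - (l : K) * β) := by
  refine ⟨?_, fun hle => ⟨α, β, h, rfl, hle⟩⟩
  rintro ⟨α', β', h', heq, hle⟩
  obtain ⟨a, ha⟩ := (Projectivization.mk_eq_mk_iff K _ _ h h').1 heq
  obtain ⟨rfl, rfl⟩ : (a : K) * α' = α ∧ (a : K) * β' = β := Prod.ext_iff.1 ha
  rw [show (a : K) * α' - l * (a * β') = a * (α' - l * β') by ring, v.map_mul, v.map_mul,
    add_left_comm]
  gcongr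

theorem mk_mem_UinfN {n : ℕ} {α β : K} (h : ((α, β) : K × K) ≠ 0) :
    Projectivization.mk K (α, β) h ∈ UinfN v n ↔ (n : WithTop ℤ) + v α ≤ v β := by
  refine ⟨?_, fun hle => ⟨α, β, h, rfl, hle⟩⟩
  rintro ⟨α', β', h', heq, hle⟩
  obtain ⟨a, ha⟩ := (Projectivization.mk_eq_mk_iff K _ _ h h').1 heq
  obtain ⟨rfl, rfl⟩ : (a : K) * α' = α ∧ (a : K) * β' = β := Prod.ext_iff.1 ha
  rw [v.map_mul, v.map_mul, add_left_comm]
  gcongr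

/-- The integer with base `p` digits `d 0, …, d (n - 1)`. -/
def digitSum (p : ℕ) (d : ℕ → ℕ) (n : ℕ) : ℕ :=
  ∑ i ∈ Finset.range n, d i * p ^ i

theorem digitSum_succ (p : ℕ) (d : ℕ → ℕ) (n : ℕ) :
    digitSum p d (n + 1) = digitSum p d n + d n * p ^ n :=
  Finset.sum_range_succ _ _

theorem add_mul_pow_lt_pow_succ {p n a b : ℕ} (ha : a < p ^ n) (hb : b < p) :
    a + b * p ^ n < p ^ (n + 1) := by
  calc a + b * p ^ n < (b + 1) * p ^ n := by linarith
    _ ≤ p * p ^ n := Nat.mul_le_mul_right _ hb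
    _ = p ^ (n + 1) := (pow_succ' p n).symm

theorem digitSum_lt_pow {p n : ℕ} {d : ℕ → ℕ} (hd : ∀ i < n, d i < p) :
    digitSum p d n < p ^ n := by
  induction n with
  | zero => simp [digitSum]
  | succ n ih =>
    rw [digitSum_succ]
    exact add_mul_pow_lt_pow_succ (ih fun i hi => hd i (hi.trans n.lt_succ_self))
      (hd n n.lt_succ_self)

theorem sub_mul_mul_ne_zero {α β c q : K} (hq : q ≠ 0) (h : ((α, β) : K × K) ≠ 0) :
    ((α - c * β, q * β) : K × K) ≠ 0 := by
  intro h0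
  obtain ⟨h1, h2⟩ := Prod.mk_eq_zero.1 h0
  obtain rfl : β = 0 := (mul_eq_zero.1 h2).resolve_left hq
  exact h (Prod.mk_eq_zero.2 ⟨by simpa using h1, rfl⟩)

theorem foldl_mk {p : ℕ} (hp : (p : K) ≠ 0)
    {t : ℕ → Projectivization K (K × K) → Projectivization K (K × K)}
    (ht : ∀ ν < p, ∀ (α β : K) (h0 : ((α, β) : K × K) ≠ 0)
      (h1 : ((α - (ν : K) * β, (p : K) * β) : K × K) ≠ 0),
      t ν (Projectivization.mk K (α, β) h0) =
        Projectivization.mk K (α - (ν : K) * β, (p : K) * β) h1)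
    {n : ℕ} {d : ℕ → ℕ} (hd : ∀ i < n, d i < p) {α β : K} (h : ((α, β) : K × K) ≠ 0) :
    (List.range n).foldl (fun y i => t (d i) y) (Projectivization.mk K (α, β) h) =
      Projectivization.mk K (α - (digitSum p d n : K) * β, (p : K) ^ n * β)
        (sub_mul_mul_ne_zero (pow_ne_zero n hp) h) := by
  induction n with
  | zero => simp [digitSum]
  | succ n ih =>
    rw [List.range_succ, List.foldl_append, ih fun i hi => hd i (hi.trans n.lt_succ_self),
      List.foldl_cons, List.foldl_nil, ht _ (hd n n.lt_succ_self) _ _ _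
        (sub_mul_mul_ne_zero hp (sub_mul_mul_ne_zero (pow_ne_zero n hp) h))]
    congr 2
    · rw [digitSum_succ]
      push_cast
      ring
    · ring

end

/-- for `n ≥ 1` and `μ = λ_0 + λ_1 p + ⋯ + λ_{n−1} p^{n−1}` with digits
`λ_i ∈ {0,…,p−1}`, writing `t_{(μ)} = t_{λ_{n−1}} ∘ ⋯ ∘ t_{λ_0}`, one has
`t_{(μ)}(ℙ¹(K) ∖ U_0^{(n+1)}) ⊆ U_∞ ∖ U_0^{(1)}` and `t_{(μ)}(U_∞^{(1)}) ⊆ U_∞^{(n+1)}`. -/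
theorem eichler_shimura_stmt2 (p : ℕ) (hp : p.Prime) (K : Type*) [Field K] [CharZero K]
    (v : AddValuation K (WithTop ℤ))
    (hv0 : ∀ x : K, v x = ⊤ ↔ x = 0) (hvp : v (p : K) = 1)
    (t : ℕ → Projectivization K (K × K) → Projectivization K (K × K))
    (ht : ∀ ν < p, ∀ (α β : K) (h0 : ((α, β) : K × K) ≠ 0)
      (h1 : ((α - (ν : K) * β, (p : K) * β) : K × K) ≠ 0),
      t ν (Projectivization.mk K (α, β) h0) =
        Projectivization.mk K (α - (ν : K) * β, (p : K) * β) h1)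
    (n : ℕ) (hn : 1 ≤ n) (lam : ℕ → ℕ) (hlam : ∀ i < n, lam i < p) :
    (fun x => (List.range n).foldl (fun y i => t (lam i) y) x) '' (U0N p v (n + 1))ᶜ ⊆
        UinfSet v \ U0N p v 1 ∧
    (fun x => (List.range n).foldl (fun y i => t (lam i) y) x) '' UinfN v 1 ⊆
        UinfN v (n + 1) := by
  have hp0 : (p : K) ≠ 0 := Nat.cast_ne_zero.2 hp.ne_zero
  have hvpn : v ((p : K) ^ n) = (n : WithTop ℤ) := by
    rw [v.map_pow, hvp, nsmul_one]
  have hμ := digitSum_lt_pow hlam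
  refine ⟨?_, ?_⟩
  · rintro _ ⟨x, hx, rfl⟩
    induction x using Projectivization.ind with
    | h w hw =>
    obtain ⟨α, β⟩ := w
    have hlt : ∀ l < p ^ (n + 1), v (α - (l : K) * β) < ((n + 1 : ℕ) : WithTop ℤ) + v β :=
      fun l hl => not_le.1 fun hle => hx ⟨l, hl, (mk_mem_U0lam hw).2 hle⟩
    beta_reduce
    rw [foldl_mk hp0 ht hlam hw]
    refine ⟨⟨_, _, _, rfl, ?_⟩, ?_⟩
    · have := hlt _ (hμ.trans (Nat.pow_lt_pow_succ hp.one_lt))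
      rw [v.map_mul, hvpn]
      generalize v (α - (digitSum p lam n : K) * β) = a at this ⊢
      generalize v β = b at this ⊢
      cases b with
      | top => simp
      | coe b =>
        lift a to ℤ using this.ne_top
        norm_cast at this ⊢
        push_cast at this
        linarith
    · rintro ⟨l, hl, hmem⟩
      rw [mk_mem_U0lam, v.map_mul, hvpn] at hmem
      refine (hlt _ (add_mul_pow_lt_pow_succ hμ (by simpa using hl))).not_ge ?_
      convert hmem using 1
      · rw [add_comm n, Nat.cast_add, add_assoc]
      · congr 1
        push_cast
        ring
  · rintro _ ⟨x, hx, rfl⟩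
    induction x using Projectivization.ind with
    | h w hw =>
    obtain ⟨α, β⟩ := w
    rw [mk_mem_UinfN, Nat.cast_one] at hx
    have hα : v α ≠ ⊤ := fun hα => by
      rw [hα, add_top, top_le_iff, hv0] at hx
      exact hw (Prod.mk_eq_zero.2 ⟨(hv0 _).1 hα, hx⟩)
    have hαβ : v α < v β := by
      refine lt_of_lt_of_le ?_ hx
      lift v α to ℤ using hα with a
      norm_cast
      linarith
    have hlt : v α < v ((digitSum p lam n : K) * β) := by
      rw [v.map_mul]
      exact hαβ.trans_le (le_add_of_nonneg_left (v.natCast_nonneg _))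
    beta_reduce
    rw [foldl_mk hp0 ht hlam hw, mk_mem_UinfN, v.map_sub_eq_of_lt_left hlt, v.map_mul, hvpn,
      Nat.cast_add, Nat.cast_one, add_assoc]
    gcongr
end

section
/- (Good/bad decomposition of the n-th iterate on U_0^{(n)}.) Let n ≥ 1, let μ ∈ {0, …, p^n−1}, and let x = [α : β] ∈ U_{0,μ}^{(n)}. For an integer λ ∈ {0, …, p^n−1} with digit expansion λ = λ_0 + ⋯ + λ_{n−1}p^{n−1} write t_{(λ)} := t_{λ_{n−1}} ∘ ⋯ ∘ t_{λ_0}, so t_{(λ)}([α : β]) = [α − λβ : p^nβ]. Then: (a) for every λ ∈ {0, …, p^n−1} with λ ≠ μ one has t_{(λ)}(x) ∈ U_∞^{(1)}; (b) if moreover x ∉ U_0^{(n+1)}, then t_{(μ)}(x) ∈ U_∞ ∖ U_0^{(1)}. -/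
theorem WithTop.lt_one_add_iff {a b : WithTop ℤ} (hb : b ≠ ⊤) : a < 1 + b ↔ a ≤ b := by
  lift b to ℤ using hb
  induction a with
  | top => simp
  | coe a =>
    have h : (1 : WithTop ℤ) + (b : WithTop ℤ) = ((1 + b : ℤ) : WithTop ℤ) := by simp
    rw [h]
    norm_cast
    omega

theorem AddValuation.map_intCast_nonneg {K : Type*} [Field K] (v : AddValuation K (WithTop ℤ))
    (k : ℤ) : 0 ≤ v (k : K) := by
  have hnat (m : ℕ) : 0 ≤ v (m : K) := by
    induction m with
    | zero => simp
    | succ m ih =>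
      rw [Nat.cast_succ]
      exact v.map_le_add ih v.map_one.ge
  obtain ⟨m, rfl | rfl⟩ := k.eq_nat_or_neg
  · exact_mod_cast hnat m
  · rw [Int.cast_neg, v.map_neg]
    exact_mod_cast hnat m

theorem AddValuation.map_natCast_pow_eq {K : Type*} [Field K] {v : AddValuation K (WithTop ℤ)}
    {p : ℕ} (hvp : v (p : K) = 1) (n : ℕ) : v ((p : K) ^ n) = n := by
  rw [v.map_pow, hvp, nsmul_one]

/-- An integer of valuation at least `n` is divisible by `p ^ n`. -/
theorem AddValuation.pow_dvd_of_le_map_intCast {K : Type*} [Field K]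
    {v : AddValuation K (WithTop ℤ)} {p : ℕ} (hp : p.Prime) (hvp : v (p : K) = 1)
    {n : ℕ} {k : ℤ} (hk : (n : WithTop ℤ) ≤ v (k : K)) : (p : ℤ) ^ n ∣ k := by
  obtain ⟨e, he, hg⟩ := (Nat.dvd_prime_pow hp).1
    (Int.natCast_dvd_natCast.1 (by simpa using Int.gcd_dvd_right k ((p : ℤ) ^ n)) :
      Int.gcd k ((p : ℤ) ^ n) ∣ p ^ n)
  have hbez := congrArg (Int.cast : ℤ → K) (Int.gcd_eq_gcd_ab k ((p : ℤ) ^ n))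
  rw [hg] at hbez
  push_cast at hbez
  have hle (a c : K) (ha : (n : WithTop ℤ) ≤ v a) (hc : 0 ≤ v c) :
      (n : WithTop ℤ) ≤ v (a * c) := by
    rw [v.map_mul]
    simpa using add_le_add ha hc
  have hne : (n : WithTop ℤ) ≤ (e : WithTop ℤ) := by
    rw [← AddValuation.map_natCast_pow_eq hvp e, hbez]
    exact v.map_le_add (hle _ _ hk (v.map_intCast_nonneg _))
      (hle _ _ (AddValuation.map_natCast_pow_eq hvp n).ge (v.map_intCast_nonneg _))
  obtain rfl : e = n := le_antisymm he (by exact_mod_cast hne)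
  have hd := Int.gcd_dvd_left k ((p : ℤ) ^ e)
  rw [hg] at hd
  exact_mod_cast hd

theorem mk_mem_U0lam_iff {K : Type*} [Field K] (v : AddValuation K (WithTop ℤ)) (n lam : ℕ)
    {α β : K} (h : ((α, β) : K × K) ≠ 0) :
    Projectivization.mk K (α, β) h ∈ U0lam v n lam ↔
      (n : WithTop ℤ) + v β ≤ v (α - (lam : K) * β) := by
  refine ⟨?_, fun hle => ⟨α, β, h, rfl, hle⟩⟩
  rintro ⟨α', β', h', heq, hle⟩
  obtain ⟨c, hc⟩ := (Projectivization.mk_eq_mk_iff' K _ _ h h').1 heq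
  simp only [Prod.smul_mk, smul_eq_mul, Prod.mk.injEq] at hc
  obtain ⟨rfl, rfl⟩ := hc
  rw [show c * α' - (lam : K) * (c * β') = c * (α' - lam * β') by ring, v.map_mul, v.map_mul,
    add_left_comm]
  gcongr

/-- The composite of the maps `t_ν` along a digit sequence. -/
theorem foldl_digit_maps_mk {K : Type*} [Field K] [CharZero K] {p : ℕ} (hp : p ≠ 0)
    {t : ℕ → Projectivization K (K × K) → Projectivization K (K × K)}
    (ht : ∀ ν < p, ∀ (α β : K) (h0 : ((α, β) : K × K) ≠ 0)
      (h1 : ((α - (ν : K) * β, (p : K) * β) : K × K) ≠ 0),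
      t ν (Projectivization.mk K (α, β) h0) =
        Projectivization.mk K (α - (ν : K) * β, (p : K) * β) h1)
    {d : ℕ → ℕ} {α β : K} (hβ : β ≠ 0) (h0 : ((α, β) : K × K) ≠ 0) (n : ℕ)
    (hd : ∀ i < n, d i < p)
    (h1 : ((α - ((∑ i ∈ Finset.range n, d i * p ^ i : ℕ) : K) * β, (p : K) ^ n * β) : K × K) ≠ 0) :
    (List.range n).foldl (fun y i => t (d i) y) (Projectivization.mk K (α, β) h0) =
      Projectivization.mk K
        (α - ((∑ i ∈ Finset.range n, d i * p ^ i : ℕ) : K) * β, (p : K) ^ n * β) h1 := by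
  have hpK : (p : K) ≠ 0 := Nat.cast_ne_zero.2 hp
  induction n with
  | zero => simp
  | succ n ih =>
    have hn : (p : K) ^ n * β ≠ 0 := mul_ne_zero (pow_ne_zero _ hpK) hβ
    rw [List.range_succ, List.foldl_append, List.foldl_cons, List.foldl_nil,
      ih (fun i hi => hd i (hi.trans n.lt_succ_self)) (by simp [hpK, hβ]),
      ht _ (hd n n.lt_succ_self) _ _ _ (by simp [hpK, hβ])]
    congr 2
    · rw [Finset.sum_range_succ]
      push_cast
      ring
    · ring

/-- good/bad decomposition of the `n`-th iterate on `U_0^{(n)}`.  Let `n ≥ 1`,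
`μ ∈ {0,…,p^n−1}` and `x ∈ U_{0,μ}^{(n)}`.  For `λ ∈ {0,…,p^n−1}` with digit expansion
`λ = λ_0 + ⋯ + λ_{n−1} p^{n−1}` write `t_{(λ)} = t_{λ_{n−1}} ∘ ⋯ ∘ t_{λ_0}`.  Then
(a) for every `λ ≠ μ` one has `t_{(λ)}(x) ∈ U_∞^{(1)}`; and (b) if moreover
`x ∉ U_0^{(n+1)}`, then `t_{(μ)}(x) ∈ U_∞ ∖ U_0^{(1)}`. -/
theorem eichler_shimura_stmt4 (p : ℕ) (hp : p.Prime) (K : Type*) [Field K] [CharZero K]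
    (v : AddValuation K (WithTop ℤ))
    (hv0 : ∀ x : K, v x = ⊤ ↔ x = 0) (hvp : v (p : K) = 1)
    (t : ℕ → Projectivization K (K × K) → Projectivization K (K × K))
    (ht : ∀ ν < p, ∀ (α β : K) (h0 : ((α, β) : K × K) ≠ 0)
      (h1 : ((α - (ν : K) * β, (p : K) * β) : K × K) ≠ 0),
      t ν (Projectivization.mk K (α, β) h0) =
        Projectivization.mk K (α - (ν : K) * β, (p : K) * β) h1)
    (n : ℕ) (hn : 1 ≤ n) (μ : ℕ) (hμ : μ < p ^ n)
    (x : Projectivization K (K × K)) (hx : x ∈ U0lam v n μ) :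
    (∀ lam < p ^ n, lam ≠ μ → ∀ d : ℕ → ℕ, (∀ i < n, d i < p) →
      lam = ∑ i ∈ Finset.range n, d i * p ^ i →
      (List.range n).foldl (fun y i => t (d i) y) x ∈ UinfN v 1) ∧
    (x ∉ U0N p v (n + 1) → ∀ d : ℕ → ℕ, (∀ i < n, d i < p) →
      μ = ∑ i ∈ Finset.range n, d i * p ^ i →
      (List.range n).foldl (fun y i => t (d i) y) x ∈ UinfSet v \ U0N p v 1) := by
  obtain ⟨α, β, h0, rfl, hle⟩ := hx
  have hpK : (p : K) ≠ 0 := Nat.cast_ne_zero.2 hp.ne_zero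
  have hβ : β ≠ 0 := by
    rintro rfl
    apply h0
    have hα : α = 0 := by simpa [hv0] using hle
    simp [hα]
  have hne (a : K) : ((a, (p : K) ^ n * β) : K × K) ≠ 0 := by simp [hpK, hβ]
  have hvβ : v β ≠ ⊤ := mt (hv0 β).1 hβ
  have hvn : v ((p : K) ^ n * β) = n + v β := by
    rw [v.map_mul, AddValuation.map_natCast_pow_eq hvp]
  have hfin : (n : WithTop ℤ) + v β ≠ ⊤ := by
    rw [← hvn]
    exact mt (hv0 _).1 (mul_ne_zero (pow_ne_zero _ hpK) hβ)
  constructor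
  · intro lam hlam hne' d hd hsum
    rw [foldl_digit_maps_mk hp.ne_zero ht hβ h0 n hd (hne _), ← hsum]
    refine ⟨_, _, hne _, rfl, ?_⟩
    rw [hvn, Nat.cast_one]
    by_contra! hlt
    have hle' : (n : WithTop ℤ) + v β ≤ v (α - (lam : K) * β) := by
      by_cases htop : v (α - (lam : K) * β) = ⊤
      · simp [htop]
      · exact (WithTop.lt_one_add_iff htop).1 hlt
    have hdiff : (n : WithTop ℤ) + v β ≤ v (((lam - μ : ℤ) : K) * β) := by
      have hsub := v.map_le_sub hle hle'
      rwa [show α - (μ : K) * β - (α - (lam : K) * β) = ((lam - μ : ℤ) : K) * β by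
        push_cast; ring] at hsub
    rw [v.map_mul] at hdiff
    have hdvd := AddValuation.pow_dvd_of_le_map_intCast hp hvp
      (WithTop.le_of_add_le_add_right hvβ hdiff)
    have hmod : μ ≡ lam [MOD p ^ n] := (Nat.modEq_iff_dvd).2 (by exact_mod_cast hdvd)
    exact hne' (hmod.eq_of_lt_of_lt hμ hlam).symm
  · intro hx d hd hsum
    have hx' (lam : ℕ) (hlam : lam < p ^ (n + 1)) :
        v (α - (lam : K) * β) < 1 + ((n : WithTop ℤ) + v β) := by
      by_contra! hge
      refine hx ⟨lam, hlam, (mk_mem_U0lam_iff v _ _ _).2 ?_⟩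
      rwa [Nat.cast_succ, add_comm (n : WithTop ℤ) 1, add_assoc]
    rw [foldl_digit_maps_mk hp.ne_zero ht hβ h0 n hd (hne _), ← hsum]
    refine ⟨⟨_, _, hne _, rfl, ?_⟩, ?_⟩
    · rw [hvn, ← WithTop.lt_one_add_iff hfin]
      exact hx' μ (hμ.trans (Nat.pow_lt_pow_succ hp.one_lt))
    · rintro ⟨lam, hlam, hmem⟩
      rw [mk_mem_U0lam_iff, hvn, Nat.cast_one] at hmem
      have hlt : μ + lam * p ^ n < p ^ (n + 1) := by
        rw [pow_one] at hlam
        calc μ + lam * p ^ n < p ^ n + lam * p ^ n := by gcongr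
          _ = (lam + 1) * p ^ n := by ring
          _ ≤ p * p ^ n := Nat.mul_le_mul_right _ hlam
          _ = p ^ (n + 1) := by ring
      refine (hx' _ hlt).not_ge ?_
      convert hmem using 2
      push_cast
      ring
end
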